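/- Let p ≥ 1 and let K ⊆ ℝ^p be the union of finitely many pairwise distinct nonempty compact sets K_1, …, K_q with q ≥ 3, each not reduced to a point, such that K_i ∩ K_{i+1} ≠ ∅ for every 1 ≤ i ≤ q−1 and diam(K) = Σ_{j=1}^q diam(K_j). Then for every 1 ≤ i ≤ q−1 the intersection K_i ∩ K_{i+1} consists of exactly one point, and K_i ∩ K_j = ∅ whenever |i − j| ≥ 2. -/

import Mathlib

open Finset in
/-- A chain of bounded sets has its extremities at distance at most the sum of the diameters. -/
theorem dist_le_sum_diam_of_chain {X : Type*} [PseudoMetricSpace X] {K : ℕ → Set X} {q : ℕ}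
    (hb : ∀ i < q, Bornology.IsBounded (K i))
    (hc : ∀ i, i + 1 < q → (K i ∩ K (i + 1)).Nonempty) {s t : ℕ} (hst : s ≤ t) (ht : t < q)
    {a b : X} (ha : a ∈ K s) (hbt : b ∈ K t) :
    dist a b ≤ ∑ k ∈ Ico s (t + 1), Metric.diam (K k) := by
  induction t, hst using Nat.le_induction generalizing b with
  | base => simpa using Metric.dist_le_diam_of_mem (hb s ht) ha hbt
  | succ t hst ih =>
    obtain ⟨x, hx, hx'⟩ := hc t ht
    rw [sum_Ico_succ_top (by omega)]
    have h₁ := ih (by omega) hx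
    have h₂ := Metric.dist_le_diam_of_mem (hb _ ht) hx' hbt
    linarith [dist_triangle a x b]

/-- The diameter of a nonempty compact set is attained. -/
theorem IsCompact.exists_dist_eq_diam {X : Type*} [PseudoMetricSpace X] {S : Set X}
    (hS : IsCompact S) (hne : S.Nonempty) : ∃ a ∈ S, ∃ b ∈ S, dist a b = Metric.diam S := by
  obtain ⟨⟨a, b⟩, ⟨ha, hb⟩, hmax⟩ := (hS.prod hS).exists_isMaxOn (hne.prod hne)
    (f := fun z : X × X => dist z.1 z.2) continuous_dist.continuousOn
  refine ⟨a, ha, b, hb, le_antisymm (Metric.dist_le_diam_of_mem hS.isBounded ha hb) ?_⟩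
  exact Metric.diam_le_of_forall_dist_le dist_nonneg fun x hx y hy =>
    hmax (Set.mk_mem_prod hx hy)

/-- In a strictly convex space, a point lying between two given points is determined by its
distances to them. -/
theorem eq_of_dist_eq_of_dist_add_dist_eq {E : Type*} [NormedAddCommGroup E] [NormedSpace ℝ E]
    [StrictConvexSpace ℝ E] {a b x y : E} (hax : dist a x = dist a y) (hxb : dist x b = dist y b)
    (h : dist a x + dist x b = dist a b) : x = y := by
  rcases eq_or_ne (dist a b) 0 with h₀ | h₀
  · have h₁ : dist a x = 0 := by
      linarith [dist_nonneg (x := a) (y := x), dist_nonneg (x := x) (y := b)]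
    exact (dist_eq_zero.1 h₁).symm.trans (dist_eq_zero.1 (hax.symm.trans h₁))
  · have key : ∀ z, dist a z = dist a x → dist z b = dist x b →
        z = AffineMap.lineMap a b (dist a x / dist a b) := fun z h₁ h₂ => by
      apply eq_lineMap_of_dist_eq_mul_of_dist_eq_mul
      · rw [h₁]; field_simp
      · rw [h₂]; field_simp; linarith
    rw [key x rfl rfl, ← key y hax.symm hxb.symm]

open Finset in
/-- If a chain of compact sets of positive diameter has a union whose diameter is the sum of the
diameters, then that sum is the distance of a point of the first set to a point of the last. -/
theorem exists_dist_eq_sum_diam_of_chain {X : Type*} [PseudoMetricSpace X] {K : ℕ → Set X} {q : ℕ}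
    (hq : 0 < q) (hK : ∀ i < q, IsCompact (K i)) (hpos : ∀ i < q, 0 < Metric.diam (K i))
    (hne : (K 0).Nonempty) (hc : ∀ i, i + 1 < q → (K i ∩ K (i + 1)).Nonempty)
    (hd : Metric.diam (⋃ i : Fin q, K i) = ∑ i ∈ range q, Metric.diam (K i)) :
    ∃ a ∈ K 0, ∃ b ∈ K (q - 1), dist a b = ∑ i ∈ range q, Metric.diam (K i) := by
  have hb : ∀ i < q, Bornology.IsBounded (K i) := fun i hi => (hK i hi).isBounded
  obtain ⟨a, ha', b, hb', hab⟩ := (isCompact_iUnion fun i : Fin q => hK i i.2).exists_dist_eq_diam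
    (hne.mono (Set.subset_iUnion (fun i : Fin q => K i) ⟨0, hq⟩))
  rw [hd] at hab
  obtain ⟨⟨s, hs⟩, ha⟩ := Set.mem_iUnion.1 ha'
  obtain ⟨⟨t, ht⟩, hbt⟩ := Set.mem_iUnion.1 hb'
  wlog hst : s ≤ t generalizing a b s t
  · exact this b hb' a ha' (by rwa [dist_comm]) t ht hbt s hs ha (by omega)
  have hle := dist_le_sum_diam_of_chain hb hc hst ht ha hbt
  rw [hab] at hle
  have hsub : Ico s (t + 1) ⊆ range q := fun k hk => by simp at hk ⊢; omega
  have hmem : ∀ k < q, k ∈ Ico s (t + 1) := fun k hk => by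
    by_contra hk'
    exact absurd hle (not_le.2 (sum_lt_sum_of_subset hsub (mem_range.2 hk) hk' (hpos k hk)
      fun _ _ _ => Metric.diam_nonneg))
  have h₀ := hmem 0 hq
  have h₁ := hmem (q - 1) (by omega)
  simp only [mem_Ico] at h₀ h₁
  obtain rfl : s = 0 := by omega
  obtain rfl : t = q - 1 := by omega
  exact ⟨a, ha, b, hbt, hab⟩


/--
Let `p ≥ 1` and let `K ⊆ ℝ^p` be the union of finitely many pairwise
distinct nonempty compact sets `K_1, …, K_q` with `q ≥ 3`, each not reduced to a point,
such that `K_i ∩ K_{i+1} ≠ ∅` for every `1 ≤ i ≤ q − 1` and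
`diam(K) = Σ_{j=1}^q diam(K_j)`. Then for every `1 ≤ i ≤ q − 1` the intersection
`K_i ∩ K_{i+1}` consists of exactly one point, and `K_i ∩ K_j = ∅` whenever `|i − j| ≥ 2`.
-/
theorem stmt1 (p q : ℕ) (hp : 1 ≤ p) (hq : 3 ≤ q)
    (K : Fin q → Set (EuclideanSpace ℝ (Fin p)))
    (hne : ∀ i, (K i).Nonempty)
    (hcpt : ∀ i, IsCompact (K i))
    (hdist : ∀ i j, i ≠ j → K i ≠ K j)
    (hnotpt : ∀ i, ∃ x ∈ K i, ∃ y ∈ K i, x ≠ y)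
    (hconsec : ∀ i : ℕ, ∀ hi : i + 1 < q,
      (K ⟨i, Nat.lt_of_succ_lt hi⟩ ∩ K ⟨i + 1, hi⟩).Nonempty)
    (hdiam : Metric.diam (⋃ i, K i) = ∑ i, Metric.diam (K i)) :
    (∀ i : ℕ, ∀ hi : i + 1 < q,
      ∃ x, K ⟨i, Nat.lt_of_succ_lt hi⟩ ∩ K ⟨i + 1, hi⟩ = {x}) ∧
    (∀ i j : Fin q, 2 ≤ |((i : ℕ) : ℤ) - ((j : ℕ) : ℤ)| → K i ∩ K j = ∅) := by
  have hbdd : ∀ i, Bornology.IsBounded (K i) := fun i => (hcpt i).isBounded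
  let L : ℕ → Set (EuclideanSpace ℝ (Fin p)) := fun n => if h : n < q then K ⟨n, h⟩ else ∅
  have hL : ∀ n (h : n < q), L n = K ⟨n, h⟩ := fun n h => dif_pos h
  have hLF : ∀ i : Fin q, L i = K i := fun i => hL i i.2
  have hLc : ∀ i < q, IsCompact (L i) := fun i hi => hL i hi ▸ hcpt _
  have hLb : ∀ i < q, Bornology.IsBounded (L i) := fun i hi => (hLc i hi).isBounded
  have hLpos : ∀ i < q, 0 < Metric.diam (L i) := fun i hi => by
    obtain ⟨x, hx, y, hy, hxy⟩ := hnotpt ⟨i, hi⟩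
    rw [hL i hi]
    exact (dist_pos.2 hxy).trans_le (Metric.dist_le_diam_of_mem (hbdd _) hx hy)
  have hLcon : ∀ i, i + 1 < q → (L i ∩ L (i + 1)).Nonempty := fun i hi => by
    rw [hL i (by omega), hL _ hi]
    exact hconsec i hi
  obtain ⟨a, ha, b, hb, hab⟩ := exists_dist_eq_sum_diam_of_chain (by omega) hLc hLpos
    (hL 0 (by omega) ▸ hne _) hLcon (by
      rw [Finset.sum_range]
      simpa only [hLF] using hdiam)
  rw [Finset.range_eq_Ico] at hab
  have hleft : ∀ i < q, ∀ x ∈ L i, dist a x ≤ ∑ k ∈ Finset.Ico 0 (i + 1), Metric.diam (L k) :=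
    fun i hi x hx => dist_le_sum_diam_of_chain hLb hLcon (Nat.zero_le i) hi ha hx
  have hright : ∀ i < q, ∀ x ∈ L i, dist x b ≤ ∑ k ∈ Finset.Ico i q, Metric.diam (L k) :=
    fun i hi x hx => by
      have := dist_le_sum_diam_of_chain hLb hLcon (Nat.le_sub_one_of_lt hi) (by omega) hx hb
      rwa [Nat.sub_add_cancel (by omega)] at this
  have hdisj : ∀ i j, i + 2 ≤ j → j < q → L i ∩ L j = ∅ := fun i j hij hj => by
    refine Set.eq_empty_of_forall_notMem fun x ⟨hxi, hxj⟩ => ?_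
    have h₁ := hleft i (by omega) x hxi
    have h₂ := hright j hj x hxj
    have h₃ := Finset.sum_Ico_consecutive (fun k => Metric.diam (L k)) (Nat.zero_le (i + 1))
      (show i + 1 ≤ q by omega)
    have h₄ := Finset.sum_Ico_consecutive (fun k => Metric.diam (L k)) (show i + 1 ≤ j by omega)
      hj.le
    have h₅ : 0 < ∑ k ∈ Finset.Ico (i + 1) j, Metric.diam (L k) :=
      Finset.sum_pos (fun k hk => hLpos k (by simp at hk; omega)) (by simpa using by omega)
    linarith [dist_triangle a x b]
  refine ⟨fun i hi => ?_, fun i j hij => ?_⟩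
  · rw [← hL, ← hL]
    have hdists : ∀ x ∈ L i ∩ L (i + 1),
        dist a x = ∑ k ∈ Finset.Ico 0 (i + 1), Metric.diam (L k) ∧
        dist x b = ∑ k ∈ Finset.Ico (i + 1) q, Metric.diam (L k) := fun x ⟨hx, hx'⟩ => by
      have h₁ := hleft i (by omega) x hx
      have h₂ := hright (i + 1) hi x hx'
      have h₃ := Finset.sum_Ico_consecutive (fun k => Metric.diam (L k)) (Nat.zero_le (i + 1)) hi.le
      have h₄ := dist_triangle a x b
      constructor <;> linarith
    obtain ⟨x, hx⟩ := hLcon i hi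
    refine ⟨x, Set.eq_singleton_iff_unique_mem.2 ⟨hx, fun y hy => ?_⟩⟩
    obtain ⟨hax, hxb⟩ := hdists x hx
    obtain ⟨hay, hyb⟩ := hdists y hy
    refine eq_of_dist_eq_of_dist_add_dist_eq (hay.trans hax.symm) (hyb.trans hxb.symm) ?_
    rw [hay, hyb, hab, Finset.sum_Ico_consecutive _ (Nat.zero_le _) hi.le]
  · rw [← hLF, ← hLF]
    rcases le_abs.1 hij with h | h
    · rw [Set.inter_comm]
      exact hdisj j i (by omega) i.2
    · exact hdisj i j (by omega) j.2
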